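/- Let λ ∈ (0,1). Let F ∈ 𝒴 be odd, G ∈ 𝒴 be even, and γ ∈ ℝ. Then there exist a, b ∈ ℝ, an even function Ã ∈ 𝒴, and an odd function B̃ ∈ 𝒴 such that A = Ã + γ and B = B̃ + b·φ satisfy the system: (LA)' + a·((3−λ)·Q'' + Q²)' = F and (LB)' + a·(3−2λ)·Q'' − (3−λ)·A'' − 2Q·A = G. -/

import Mathlib

open Real MeasureTheory Filter

noncomputable section

/-- `Qs x = (3/2) * sech²(x/2)`. -/
def Qs (x : ℝ) : ℝ := (3/2) * (1 / Real.cosh (x/2))^2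

/-- The solitary wave profile `φ_c`. -/
def phic (c : ℝ) (x : ℝ) : ℝ := (c - 1) * Qs (Real.sqrt ((c - 1)/c) * x)

/-- The linearized operator `L f = -f'' + f - 2 Q f`. -/
def Lop (f : ℝ → ℝ) (x : ℝ) : ℝ := -(iteratedDeriv 2 f x) + f x - 2 * Qs x * f x

/-- `φ = -Q'/Q`. -/
def phi0 (x : ℝ) : ℝ := -(deriv Qs x / Qs x)

/-- `P_λ = 2Q + ((3-λ)/2) x Q'`. -/
def Pl (lam : ℝ) (x : ℝ) : ℝ := 2 * Qs x + ((3 - lam)/2) * x * deriv Qs x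

/-- The space `𝒴` of smooth functions with exponential decay of all derivatives. -/
def inY (f : ℝ → ℝ) : Prop :=
  ContDiff ℝ (⊤ : ℕ∞) f ∧ ∀ j : ℕ, ∃ K r : ℝ, 0 < K ∧ 0 < r ∧
    ∀ x : ℝ, |iteratedDeriv j f x| ≤ K * (1 + |x|) ^ r * Real.exp (-|x|)

/-- The `H¹(ℝ)` norm. -/
def H1norm (v : ℝ → ℝ) : ℝ := Real.sqrt (∫ x : ℝ, ((v x)^2 + (deriv v x)^2))

/-- The `H¹` norm restricted to a set. -/
def H1normOn (s : Set ℝ) (v : ℝ → ℝ) : ℝ :=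
  Real.sqrt (∫ x in s, ((v x)^2 + (deriv v x)^2))

/-- The weighted norm `H¹_c`. -/
def H1cnorm (c : ℝ) (v : ℝ → ℝ) : ℝ :=
  Real.sqrt (∫ x : ℝ, ((deriv v x)^2 + (c - 1) * (v x)^2))

/-- The `L²(ℝ)` norm. -/
def L2norm (v : ℝ → ℝ) : ℝ := Real.sqrt (∫ x : ℝ, (v x)^2)

/-- The BBM residual `(1-∂ₓ²)∂ₜu + ∂ₓ(u+u²)` at `(t,x)`. -/
def bbmRes (u : ℝ → ℝ → ℝ) (t x : ℝ) : ℝ :=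
  deriv (fun s => u s x) t
    - iteratedDeriv 2 (fun y => deriv (fun s => u s y) t) x
    + deriv (fun y => u t y + (u t y)^2) x

/-- An `H¹` solution of the BBM equation. -/
def IsBBMSol (u : ℝ → ℝ → ℝ) : Prop :=
  (Continuous fun p : ℝ × ℝ => u p.1 p.2) ∧
  (∀ t : ℝ, Integrable (fun x => (u t x)^2) ∧ Integrable (fun x => (deriv (u t) x)^2)) ∧
  (∀ t x : ℝ, bbmRes u t x = 0)

/-- The energy `E(u) = ∫ (u²/2 + u³/3)`. -/
def Efun (u : ℝ → ℝ) : ℝ := ∫ x : ℝ, ((u x)^2/2 + (u x)^3/3)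

/-- `N(u) = (1/2) ∫ (uₓ² + u²)`. -/
def Nfun (u : ℝ → ℝ) : ℝ := (1/2) * ∫ x : ℝ, ((deriv u x)^2 + (u x)^2)

/-- The collision time scale `T`. -/
def Tcol (c1 c2 : ℝ) : ℝ :=
  ((c2 - 1)/c2) ^ (-(1/2 : ℝ) - 1/100)
    * ((1 - (c1 - 1)/c1)/((c1 - 1)/c1)) * ((c1 - 1)/c1) ^ ((1 : ℝ)/100)

/-- The index set `Σ₀ = {(k,l) : k ≥ 1, k+l ≤ 3}`. -/
def Sigma0 : Finset (ℕ × ℕ) :=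
  (Finset.range 4 ×ˢ Finset.range 4).filter (fun p => 1 ≤ p.1 ∧ p.1 + p.2 ≤ 3)

end


/-- `f` is bounded by a polynomial in `|x|` times `exp (s |x|)`. -/
def ExpBound (s : ℝ) (f : ℝ → ℝ) : Prop :=
  ∃ (K : ℝ) (n : ℕ), 0 ≤ K ∧ ∀ x, |f x| ≤ K * ((1 + |x|) ^ n * Real.exp (s * |x|))

/-- `f` is `n` times differentiable and its first `n` derivatives satisfy `ExpBound s`. -/
def ExpBoundDeriv (s : ℝ) : ℕ → (ℝ → ℝ) → Prop
  | 0, f => ExpBound s f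
  | n + 1, f => ExpBound s f ∧ Differentiable ℝ f ∧ ExpBoundDeriv s n (deriv f)

/-- The smooth functions all of whose derivatives satisfy `ExpBound s`. -/
def ExpClass (s : ℝ) (f : ℝ → ℝ) : Prop := ∀ n, ExpBoundDeriv s n f

namespace ExpBound

variable {s t r : ℝ} {f g : ℝ → ℝ}

theorem mono (hf : ExpBound s f) (h : s ≤ t) : ExpBound t f := by
  obtain ⟨K, n, hK, hb⟩ := hf
  refine ⟨K, n, hK, fun x => (hb x).trans ?_⟩
  gcongr

theorem add (hf : ExpBound s f) (hg : ExpBound s g) : ExpBound s (fun x => f x + g x) := by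
  obtain ⟨K, n, hK, hb⟩ := hf
  obtain ⟨M, m, hM, hc⟩ := hg
  refine ⟨K + M, n + m, by positivity, fun x => ?_⟩
  have h1 : (1 : ℝ) ≤ 1 + |x| := by linarith [abs_nonneg x]
  calc |f x + g x| ≤ |f x| + |g x| := abs_add_le _ _
    _ ≤ K * ((1 + |x|) ^ n * Real.exp (s * |x|)) + M * ((1 + |x|) ^ m * Real.exp (s * |x|)) :=
      add_le_add (hb x) (hc x)
    _ ≤ K * ((1 + |x|) ^ (n + m) * Real.exp (s * |x|)) +
        M * ((1 + |x|) ^ (n + m) * Real.exp (s * |x|)) := by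
      gcongr <;> first | exact h1 | omega
    _ = _ := by ring

theorem mul (hf : ExpBound s f) (hg : ExpBound t g) (h : s + t ≤ r) :
    ExpBound r (fun x => f x * g x) := by
  obtain ⟨K, n, hK, hb⟩ := hf
  obtain ⟨M, m, hM, hc⟩ := hg
  refine mono ⟨K * M, n + m, by positivity, fun x => ?_⟩ h
  rw [abs_mul]
  calc |f x| * |g x|
      ≤ (K * ((1 + |x|) ^ n * Real.exp (s * |x|))) * (M * ((1 + |x|) ^ m * Real.exp (t * |x|))) :=
      mul_le_mul (hb x) (hc x) (abs_nonneg _) ((abs_nonneg _).trans (hb x))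
    _ = _ := by rw [add_mul, Real.exp_add, pow_add]; ring

theorem const (c : ℝ) : ExpBound 0 (fun _ => c) := ⟨|c|, 0, abs_nonneg c, by simp⟩

end ExpBound

namespace ExpBoundDeriv

variable {s t r : ℝ} {f g : ℝ → ℝ} {n : ℕ}

theorem expBound (hf : ExpBoundDeriv s n f) : ExpBound s f := by
  cases n with
  | zero => exact hf
  | succ n => exact hf.1

theorem succ_of_hasDerivAt (hf : ExpBound s f) (h : ∀ x, HasDerivAt f (g x) x)
    (hg : ExpBoundDeriv s n g) : ExpBoundDeriv s (n + 1) f := by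
  refine ⟨hf, fun x => (h x).differentiableAt, ?_⟩
  rwa [show deriv f = g from funext fun x => (h x).deriv]

theorem of_succ (hf : ExpBoundDeriv s (n + 1) f) : ExpBoundDeriv s n f := by
  induction n generalizing f with
  | zero => exact hf.1
  | succ n ih => exact ⟨hf.1, hf.2.1, ih hf.2.2⟩

theorem mono (hf : ExpBoundDeriv s n f) (h : s ≤ t) : ExpBoundDeriv t n f := by
  induction n generalizing f with
  | zero => exact ExpBound.mono hf h
  | succ n ih => exact ⟨hf.1.mono h, hf.2.1, ih hf.2.2⟩

theorem add (hf : ExpBoundDeriv s n f) (hg : ExpBoundDeriv s n g) :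
    ExpBoundDeriv s n (fun x => f x + g x) := by
  induction n generalizing f g with
  | zero => exact ExpBound.add hf hg
  | succ n ih =>
    exact succ_of_hasDerivAt (hf.1.add hg.1)
      (fun x => (hf.2.1 x).hasDerivAt.add (hg.2.1 x).hasDerivAt) (ih hf.2.2 hg.2.2)

theorem mul (hf : ExpBoundDeriv s n f) (hg : ExpBoundDeriv t n g) (h : s + t ≤ r) :
    ExpBoundDeriv r n (fun x => f x * g x) := by
  induction n generalizing f g with
  | zero => exact ExpBound.mul hf hg h
  | succ n ih =>
    exact succ_of_hasDerivAt (hf.1.mul hg.1 h)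
      (fun x => (hf.2.1 x).hasDerivAt.mul (hg.2.1 x).hasDerivAt)
      ((ih hf.2.2 hg.of_succ).add (ih hf.of_succ hg.2.2))

theorem const (c : ℝ) : ExpBoundDeriv 0 n (fun _ => c) := by
  induction n generalizing c with
  | zero => exact ExpBound.const c
  | succ n ih => exact succ_of_hasDerivAt (ExpBound.const c) (fun x => hasDerivAt_const x c) (ih 0)

end ExpBoundDeriv

namespace ExpClass

variable {s t r : ℝ} {f g : ℝ → ℝ}

theorem expBound (hf : ExpClass s f) : ExpBound s f := hf 0

theorem differentiable (hf : ExpClass s f) : Differentiable ℝ f := (hf 1).2.1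

theorem continuous (hf : ExpClass s f) : Continuous f := hf.differentiable.continuous

protected theorem deriv (hf : ExpClass s f) : ExpClass s (deriv f) := fun n => (hf (n + 1)).2.2

theorem of_hasDerivAt (hf : ExpBound s f) (h : ∀ x, HasDerivAt f (g x) x) (hg : ExpClass s g) :
    ExpClass s f
  | 0 => hf
  | n + 1 => ExpBoundDeriv.succ_of_hasDerivAt hf h (hg n)

theorem mono (hf : ExpClass s f) (h : s ≤ t) : ExpClass t f := fun n => (hf n).mono h

theorem add (hf : ExpClass s f) (hg : ExpClass s g) : ExpClass s (fun x => f x + g x) :=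
  fun n => (hf n).add (hg n)

theorem mul (hf : ExpClass s f) (hg : ExpClass t g) (h : s + t ≤ r) :
    ExpClass r (fun x => f x * g x) :=
  fun n => (hf n).mul (hg n) h

theorem const (c : ℝ) : ExpClass 0 (fun _ => c) := fun _ => ExpBoundDeriv.const c

theorem const_mul (c : ℝ) (hf : ExpClass s f) : ExpClass s (fun x => c * f x) :=
  (const c).mul hf (by simp)

theorem neg (hf : ExpClass s f) : ExpClass s (fun x => -f x) := by
  simpa using hf.const_mul (-1)

theorem sub (hf : ExpClass s f) (hg : ExpClass s g) : ExpClass s (fun x => f x - g x) := by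
  simpa [sub_eq_add_neg] using hf.add hg.neg

theorem pow_two (hf : ExpClass s f) (h : s + s ≤ t) : ExpClass t (fun x => f x ^ 2) := by
  simpa [sq] using hf.mul hf h

protected theorem id : ExpClass 0 (fun x => x) := by
  refine of_hasDerivAt ⟨1, 1, zero_le_one, fun x => ?_⟩ hasDerivAt_id (const 1)
  simp

theorem contDiff_nat (hf : ExpClass s f) (n : ℕ) : ContDiff ℝ n f := by
  induction n generalizing f with
  | zero => exact contDiff_zero.2 hf.continuous
  | succ n ih =>
    rw [Nat.cast_succ, contDiff_succ_iff_deriv]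
    exact ⟨hf.differentiable, by simp, ih hf.deriv⟩

protected theorem iteratedDeriv (hf : ExpClass s f) (n : ℕ) : ExpClass s (iteratedDeriv n f) := by
  induction n generalizing f with
  | zero => simpa using hf
  | succ n ih => rw [iteratedDeriv_succ']; exact ih hf.deriv

theorem of_inY (hf : inY f) : ExpClass (-1) f := by
  intro n
  induction n generalizing f with
  | zero =>
    obtain ⟨K, r, hK, hr, hb⟩ := hf.2 0
    refine ⟨K, ⌈r⌉₊, hK.le, fun x => ?_⟩
    have h := hb x
    rw [iteratedDeriv_zero] at h
    refine h.trans ?_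
    rw [mul_assoc, neg_one_mul, ← Real.rpow_natCast]
    gcongr
    · linarith [abs_nonneg x]
    · exact Nat.le_ceil r
  | succ n ih =>
    have hd := contDiff_infty_iff_deriv.1 hf.1
    have h' : inY (deriv f) :=
      ⟨hd.2, fun j => by simpa only [iteratedDeriv_succ'] using hf.2 (j + 1)⟩
    have h0 : ExpBound (-1) f := (ih hf).expBound
    exact ⟨h0, hd.1, ih h'⟩

protected theorem inY (hf : ExpClass (-1) f) : inY f := by
  refine ⟨contDiff_infty.2 hf.contDiff_nat, fun j => ?_⟩
  obtain ⟨K, n, hK, hb⟩ := (hf.iteratedDeriv j).expBound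
  refine ⟨K + 1, n + 1, by positivity, by positivity, fun x => (hb x).trans ?_⟩
  have h1 : (1 : ℝ) ≤ 1 + |x| := by linarith [abs_nonneg x]
  rw [← mul_assoc, neg_one_mul, ← Real.rpow_natCast]
  gcongr <;> linarith

end ExpClass

theorem one_add_pow_mul_exp_le {s u : ℝ} (hs : s < 0) (hu : 0 ≤ u) (m : ℕ) :
    (1 + u) ^ m * Real.exp (s * u) ≤ m.factorial * Real.exp (-s) / (-s) ^ m := by
  have h := Real.pow_div_factorial_le_exp (-s * (1 + u)) (by nlinarith) m
  have hs' : 0 < -s := by linarith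
  rw [mul_pow, div_le_iff₀ (by positivity)] at h
  rw [le_div_iff₀ (by positivity)]
  have he : Real.exp (-s * (1 + u)) * Real.exp (s * u) = Real.exp (-s) := by
    rw [← Real.exp_add]; ring_nf
  nlinarith [mul_le_mul_of_nonneg_right h (Real.exp_pos (s * u)).le]

theorem integrable_one_add_pow_mul_exp {s : ℝ} (hs : s < 0) (n : ℕ) :
    Integrable (fun x : ℝ => (1 + |x|) ^ n * Real.exp (s * |x|)) := by
  have h : Integrable (fun x : ℝ => (1 + ‖x‖) ^ (-(2 : ℝ))) :=
    integrable_one_add_norm (by simp)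
  refine (h.const_mul ((n + 2).factorial * Real.exp (-s) / (-s) ^ (n + 2))).mono'
    (by fun_prop) (Eventually.of_forall fun x => ?_)
  have h1 : 0 < 1 + |x| := by positivity
  have hb := one_add_pow_mul_exp_le hs (abs_nonneg x) (n + 2)
  rw [Real.norm_of_nonneg (by positivity), Real.rpow_neg (by positivity), Real.norm_eq_abs,
    ← div_eq_mul_inv, le_div_iff₀ (by positivity)]
  refine le_trans (le_of_eq ?_) hb
  norm_cast
  ring

theorem ExpBound.integrable {s : ℝ} {f : ℝ → ℝ} (hs : s < 0) (hf : ExpBound s f)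
    (hc : Continuous f) : Integrable f := by
  obtain ⟨K, n, hK, hb⟩ := hf
  exact ((integrable_one_add_pow_mul_exp hs n).const_mul K).mono' hc.aestronglyMeasurable
    (Eventually.of_forall hb)

theorem ExpClass.integrable {s : ℝ} {f : ℝ → ℝ} (hf : ExpClass s f) (hs : s < 0) : Integrable f :=
  hf.expBound.integrable hs hf.continuous

theorem ExpClass.integral_eq_zero_of_hasDerivAt {s : ℝ} {f g : ℝ → ℝ} (hs : s < 0)
    (hf : ExpClass s f) (h : ∀ x, HasDerivAt f (g x) x) : ∫ x, g x = 0 := by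
  have hg : deriv f = g := funext fun x => (h x).deriv
  exact integral_eq_zero_of_hasDerivAt_of_integrable h (hg ▸ hf.deriv.integrable hs)
    (hf.integrable hs)

/-- Tail estimate for an exponentially decaying function. -/
theorem abs_setIntegral_le {s K x : ℝ} {n : ℕ} {f : ℝ → ℝ} {S : Set ℝ} (hs : s < 0) (hK : 0 ≤ K)
    (hb : ∀ y, |f y| ≤ K * ((1 + |y|) ^ n * Real.exp (s * |y|))) (hS : MeasurableSet S)
    (hx : ∀ y ∈ S, |y| = |x| + |y - x|) :
    |∫ y in S, f y| ≤ K * (∫ y, (1 + |y|) ^ n * Real.exp (s * |y|)) *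
      ((1 + |x|) ^ n * Real.exp (s * |x|)) := by
  have hi := integrable_one_add_pow_mul_exp hs n
  have hi' : Integrable fun y => K * ((1 + |x|) ^ n * Real.exp (s * |x|)) *
      ((1 + |y - x|) ^ n * Real.exp (s * |y - x|)) :=
    (hi.comp_sub_right x).const_mul _
  calc |∫ y in S, f y|
      ≤ ∫ y in S, K * ((1 + |x|) ^ n * Real.exp (s * |x|)) *
          ((1 + |y - x|) ^ n * Real.exp (s * |y - x|)) := by
        refine norm_integral_le_of_norm_le (f := f) hi'.integrableOn
          ((ae_restrict_iff' hS).2 (Eventually.of_forall fun y hy => ?_))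
        rw [Real.norm_eq_abs]
        refine (hb y).trans ?_
        rw [hx y hy, mul_add, Real.exp_add]
        calc K * ((1 + (|x| + |y - x|)) ^ n * (Real.exp (s * |x|) * Real.exp (s * |y - x|)))
            ≤ K * (((1 + |x|) * (1 + |y - x|)) ^ n *
              (Real.exp (s * |x|) * Real.exp (s * |y - x|))) := by
              gcongr
              nlinarith [mul_nonneg (abs_nonneg x) (abs_nonneg (y - x))]
          _ = _ := by rw [mul_pow]; ring
    _ ≤ ∫ y, K * ((1 + |x|) ^ n * Real.exp (s * |x|)) *
          ((1 + |y - x|) ^ n * Real.exp (s * |y - x|)) :=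
        setIntegral_le_integral hi' (Eventually.of_forall fun y => by positivity)
    _ = _ := by
        rw [integral_const_mul,
          integral_sub_right_eq_self (fun y : ℝ => (1 + |y|) ^ n * Real.exp (s * |y|)) x]
        ring

/-- An exponentially decaying function of zero mean has a decaying antiderivative. -/
theorem ExpClass.exists_antideriv {s ε : ℝ} {f : ℝ → ℝ} (hs : s < 0) (hf : ExpClass s f)
    (hpar : ∀ x, f (-x) = ε * f x) (h0 : ∫ x, f x = 0) :
    ∃ g, ExpClass s g ∧ (∀ x, g (-x) = -ε * g x) ∧ ∀ x, HasDerivAt g (f x) x := by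
  have hi := hf.integrable hs
  have hsum : ∀ x, (∫ y in Set.Iic x, f y) + ∫ y in Set.Ioi x, f y = 0 := fun x => by
    rw [intervalIntegral.integral_Iic_add_Ioi hi.integrableOn hi.integrableOn, h0]
  have hder : ∀ x, HasDerivAt (fun x => ∫ y in Set.Iic x, f y) (f x) x := fun x => by
    have h := (intervalIntegral.integral_hasDerivAt_right (hf.continuous.intervalIntegrable 0 x)
      (hf.continuous.stronglyMeasurableAtFilter _ _)
      hf.continuous.continuousAt).const_add (∫ y in Set.Iic 0, f y)
    refine h.congr_of_eventuallyEq (Eventually.of_forall fun z => ?_)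
    simp only [← intervalIntegral.integral_Iic_sub_Iic (hi.integrableOn (s := Set.Iic 0))
      (hi.integrableOn (s := Set.Iic z))]
    ring
  refine ⟨fun x => ∫ y in Set.Iic x, f y, of_hasDerivAt ?_ hder hf, fun x => ?_, hder⟩
  · obtain ⟨K, n, hK, hb⟩ := hf.expBound
    refine ⟨K * (∫ y, (1 + |y|) ^ n * Real.exp (s * |y|)), n,
      mul_nonneg hK (integral_nonneg fun y => by positivity), fun x => ?_⟩
    rcases le_total x 0 with hx | hx
    · refine abs_setIntegral_le hs hK hb measurableSet_Iic fun y hy => ?_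
      have hy : y ≤ x := hy
      rw [abs_of_nonpos hx, abs_of_nonpos (hy.trans hx), abs_of_nonpos (by linarith)]
      ring
    · beta_reduce
      rw [eq_neg_of_add_eq_zero_left (hsum x), abs_neg]
      refine abs_setIntegral_le hs hK hb measurableSet_Ioi fun y hy => ?_
      have hy : x < y := hy
      rw [abs_of_nonneg hx, abs_of_nonneg (hx.trans hy.le), abs_of_nonneg (by linarith)]
      ring
  · have h := integral_comp_neg_Iic (-x) f
    simp only [hpar, neg_neg, integral_const_mul] at h
    have h2 := integral_comp_neg_Iic (-x) (fun y => f (-y))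
    simp only [neg_neg, hpar, integral_const_mul] at h2
    simp only
    rw [h2, eq_neg_of_add_eq_zero_right (hsum x)]
    ring

/-- Antiderivatives of functions of polynomial growth have polynomial growth. -/
protected theorem ExpClass.intervalIntegral {f : ℝ → ℝ} (hf : ExpClass 0 f) :
    ExpClass 0 (fun x => ∫ y in (0 : ℝ)..x, f y) := by
  refine of_hasDerivAt ?_ (fun x => intervalIntegral.integral_hasDerivAt_right
    (hf.continuous.intervalIntegrable 0 x) (hf.continuous.stronglyMeasurableAtFilter _ _)
    hf.continuous.continuousAt) hf
  obtain ⟨K, n, hK, hb⟩ := hf.expBound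
  refine ⟨K, n + 1, hK, fun x => ?_⟩
  have h : ∀ y ∈ Set.uIoc 0 x, ‖f y‖ ≤ K * (1 + |x|) ^ n := fun y hy => by
    refine (hb y).trans ?_
    have hy' : |y| ≤ |x| := by
      simpa using Set.abs_sub_left_of_mem_uIcc (Set.uIoc_subset_uIcc hy)
    simp only [zero_mul, Real.exp_zero, mul_one]
    gcongr
  refine (intervalIntegral.norm_integral_le_of_norm_le_const h).trans ?_
  rw [sub_zero, zero_mul, Real.exp_zero, mul_one, pow_succ, ← mul_assoc]
  gcongr
  linarith

theorem intervalIntegral_neg_of_parity {ε : ℝ} {f : ℝ → ℝ} (hpar : ∀ x, f (-x) = ε * f x) (x : ℝ) :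
    ∫ y in (0 : ℝ)..(-x), f y = -ε * ∫ y in (0 : ℝ)..x, f y := by
  have h := intervalIntegral.integral_comp_neg (a := 0) (b := x) f
  simp only [hpar, neg_zero, intervalIntegral.integral_const_mul] at h
  rw [intervalIntegral.integral_symm, ← h]
  ring

theorem integral_eq_zero_of_odd {f : ℝ → ℝ} (hf : ∀ x, f (-x) = -f x) : ∫ x, f x = 0 := by
  have h := integral_neg_eq_self f volume
  simp only [hf, integral_neg] at h
  linarith

theorem hasDerivAt_Qs_aux (x : ℝ) :
    HasDerivAt Qs (-(Real.sinh (x / 2) / Real.cosh (x / 2) * Qs x)) x := by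
  have hc := (Real.cosh_pos (x / 2)).ne'
  have h := ((((hasDerivAt_id x).div_const 2).cosh.fun_inv hc).fun_pow 2).const_mul (3 / 2 : ℝ)
  refine (h.congr_of_eventuallyEq (Eventually.of_forall fun y => ?_)).congr_deriv ?_
  · simp [Qs]
  · simp only [Qs, id]
    push_cast
    field_simp

theorem Qs_pos (x : ℝ) : 0 < Qs x := by
  have := Real.cosh_pos (x / 2)
  unfold Qs
  positivity

theorem phi0_eq (x : ℝ) : phi0 x = Real.sinh (x / 2) / Real.cosh (x / 2) := by
  rw [phi0, (hasDerivAt_Qs_aux x).deriv, neg_div, neg_neg, mul_div_cancel_right₀ _ (Qs_pos x).ne']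

theorem hasDerivAt_Qs (x : ℝ) : HasDerivAt Qs (-(phi0 x * Qs x)) x := by
  rw [phi0_eq]
  exact hasDerivAt_Qs_aux x

theorem Qs_eq_phi0 (x : ℝ) : Qs x = 3 / 2 * (1 - phi0 x ^ 2) := by
  have hc := (Real.cosh_pos (x / 2)).ne'
  rw [Qs, phi0_eq]
  field_simp
  linear_combination (-1 : ℝ) * Real.cosh_sq (x / 2)

theorem hasDerivAt_phi0 (x : ℝ) : HasDerivAt phi0 (Qs x / 3) x := by
  have hc := (Real.cosh_pos (x / 2)).ne'
  have h := ((hasDerivAt_id x).div_const 2).sinh.fun_div ((hasDerivAt_id x).div_const 2).cosh hc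
  rw [show phi0 = _ from funext phi0_eq]
  refine h.congr_deriv ?_
  simp only [Qs, id]
  field_simp
  linear_combination Real.cosh_sq (x / 2)

theorem Qs_neg (x : ℝ) : Qs (-x) = Qs x := by
  simp [Qs, neg_div]

theorem phi0_neg (x : ℝ) : phi0 (-x) = -phi0 x := by
  simp [phi0_eq, neg_div]

theorem Qs_mul_cosh (x : ℝ) : Qs x * Real.cosh x = 3 - Qs x := by
  have hc := (Real.cosh_pos (x / 2)).ne'
  have h := Real.cosh_two_mul (x / 2)
  rw [Real.sinh_sq, mul_div_cancel₀ x two_ne_zero] at h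
  rw [h, Qs]
  field_simp
  ring

theorem Qs_mul_sinh (x : ℝ) : Qs x * Real.sinh x = 3 * phi0 x := by
  have hc := (Real.cosh_pos (x / 2)).ne'
  have h := Real.sinh_two_mul (x / 2)
  rw [mul_div_cancel₀ x two_ne_zero] at h
  rw [h, Qs, phi0_eq]
  field_simp

theorem expBound_Qs : ExpBound (-1) Qs := by
  refine ⟨6, 0, by norm_num, fun x => ?_⟩
  rw [abs_of_pos (Qs_pos x), pow_zero, one_mul, neg_one_mul, Real.exp_neg]
  have h : Real.exp (|x| / 2) ≤ 2 * Real.cosh (x / 2) := by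
    rw [← Real.cosh_abs, abs_div, abs_two, Real.cosh_eq]
    linarith [Real.exp_pos (-(|x| / 2))]
  have h2 : Real.exp |x| = Real.exp (|x| / 2) ^ 2 := by
    rw [← Real.exp_nat_mul]; ring_nf
  have hc := Real.cosh_pos (x / 2)
  rw [h2, Qs, one_div, inv_pow, ← div_eq_mul_inv, ← div_eq_mul_inv,
    div_le_div_iff₀ (by positivity) (by positivity)]
  nlinarith [Real.exp_pos (|x| / 2)]

theorem expBound_phi0 : ExpBound 0 phi0 := by
  refine ⟨1, 0, zero_le_one, fun x => ?_⟩
  have := Qs_eq_phi0 x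
  have := Qs_pos x
  simpa using abs_le_one_iff_mul_self_le_one.2 (by nlinarith)

theorem expBoundDeriv_Qs_phi0 (n : ℕ) : ExpBoundDeriv (-1) n Qs ∧ ExpBoundDeriv 0 n phi0 := by
  induction n with
  | zero => exact ⟨expBound_Qs, expBound_phi0⟩
  | succ n ih =>
    refine ⟨.succ_of_hasDerivAt expBound_Qs hasDerivAt_Qs ?_,
      .succ_of_hasDerivAt expBound_phi0 hasDerivAt_phi0 ?_⟩
    · simpa using (ExpBoundDeriv.const (-1)).mul (ih.2.mul ih.1 (r := -1) (by simp))
        (r := -1) (by simp)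
    · simpa [div_eq_inv_mul] using (ExpBoundDeriv.const 3⁻¹).mul ih.1 (r := 0) (by simp)

theorem expClass_Qs : ExpClass (-1) Qs := fun n => (expBoundDeriv_Qs_phi0 n).1

theorem expClass_phi0 : ExpClass 0 phi0 := fun n => (expBoundDeriv_Qs_phi0 n).2

theorem expClass_phi0_mul_Qs : ExpClass (-1) (fun x => phi0 x * Qs x) :=
  expClass_phi0.mul expClass_Qs (by simp)

theorem hasDerivAt_phi0_mul_Qs (x : ℝ) :
    HasDerivAt (fun x => phi0 x * Qs x) (Qs x ^ 2 - Qs x) x := by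
  refine ((hasDerivAt_phi0 x).mul (hasDerivAt_Qs x)).congr_deriv ?_
  rw [Qs_eq_phi0]
  ring

theorem hasDerivAt_Qs_sq (x : ℝ) :
    HasDerivAt (fun x => Qs x ^ 2) (-(2 * phi0 x * Qs x ^ 2)) x := by
  refine ((hasDerivAt_Qs x).fun_pow 2).congr_deriv ?_
  ring

theorem integral_Qs_pos : 0 < ∫ x, Qs x := by
  have hs : Function.support Qs = Set.univ :=
    Set.eq_univ_of_forall fun x => (Qs_pos x).ne'
  rw [integral_pos_iff_support_of_nonneg (fun x => (Qs_pos x).le)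
    (expClass_Qs.integrable (by norm_num)), hs]
  simp

theorem abs_cosh_le_and_abs_sinh_le (x : ℝ) :
    |Real.cosh x| ≤ Real.exp |x| ∧ |Real.sinh x| ≤ Real.exp |x| := by
  have h1 := Real.exp_le_exp.2 (le_abs_self x)
  have h2 := Real.exp_le_exp.2 (neg_le_abs x)
  have h3 := Real.exp_pos x
  have h4 := Real.exp_pos (-x)
  rw [Real.cosh_eq, Real.sinh_eq, abs_le, abs_le]
  refine ⟨⟨?_, ?_⟩, ?_, ?_⟩ <;> linarith

theorem expBoundDeriv_cosh_sinh (n : ℕ) :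
    ExpBoundDeriv 1 n Real.cosh ∧ ExpBoundDeriv 1 n Real.sinh := by
  have hc : ExpBound 1 Real.cosh :=
    ⟨1, 0, zero_le_one, fun x => by simpa using (abs_cosh_le_and_abs_sinh_le x).1⟩
  have hs : ExpBound 1 Real.sinh :=
    ⟨1, 0, zero_le_one, fun x => by simpa using (abs_cosh_le_and_abs_sinh_le x).2⟩
  induction n with
  | zero => exact ⟨hc, hs⟩
  | succ n ih =>
    exact ⟨.succ_of_hasDerivAt hc Real.hasDerivAt_cosh ih.2,
      .succ_of_hasDerivAt hs Real.hasDerivAt_sinh ih.1⟩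

theorem expClass_cosh : ExpClass 1 Real.cosh := fun n => (expBoundDeriv_cosh_sinh n).1

/-- The even, exponentially growing solution of `L q = 0`. -/
noncomputable def growingSol (x : ℝ) : ℝ := Real.cosh x + 6 - 10 * Qs x + 5 * (x * (phi0 x * Qs x))

/-- The derivative of `growingSol`. -/
noncomputable def growingSolDeriv (x : ℝ) : ℝ :=
  Real.sinh x + 15 * (phi0 x * Qs x) + 5 * (x * (Qs x ^ 2 - Qs x))

theorem hasDerivAt_growingSol (x : ℝ) : HasDerivAt growingSol (growingSolDeriv x) x := by
  refine ((((Real.hasDerivAt_cosh x).add_const 6).sub ((hasDerivAt_Qs x).const_mul 10)).add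
    (((hasDerivAt_id x).mul (hasDerivAt_phi0_mul_Qs x)).const_mul 5)).congr_deriv ?_
  simp only [growingSolDeriv, id]
  ring

theorem hasDerivAt_growingSolDeriv (x : ℝ) :
    HasDerivAt growingSolDeriv (growingSol x - 2 * Qs x * growingSol x) x := by
  refine (((Real.hasDerivAt_sinh x).add ((hasDerivAt_phi0_mul_Qs x).const_mul 15)).add
    (((hasDerivAt_id x).mul ((hasDerivAt_Qs_sq x).fun_sub (hasDerivAt_Qs x))).const_mul 5)).congr_deriv
    ?_
  simp only [growingSol, id]
  linear_combination 2 * Qs_mul_cosh x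

theorem growingSol_neg (x : ℝ) : growingSol (-x) = growingSol x := by
  simp [growingSol, Qs_neg, phi0_neg]

theorem expClass_growingSol : ExpClass 1 growingSol := by
  have h1 : ExpClass 1 (fun _ => (6 : ℝ)) := (ExpClass.const 6).mono zero_le_one
  have h2 : ExpClass 1 Qs := expClass_Qs.mono (by norm_num)
  have h3 : ExpClass 1 (fun x => x * (phi0 x * Qs x)) :=
    ExpClass.id.mul expClass_phi0_mul_Qs (by norm_num)
  exact ((expClass_cosh.add h1).sub (h2.const_mul 10)).add (h3.const_mul 5)

theorem wronskian_growingSol (x : ℝ) :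
    growingSol x * (Qs x ^ 2 - Qs x) - growingSolDeriv x * (phi0 x * Qs x) = -6 := by
  rw [growingSol, growingSolDeriv]
  have h := Qs_eq_phi0 x
  have h' : phi0 x ^ 2 = 1 - 2 / 3 * Qs x := by linarith
  linear_combination (Qs x - 1) * Qs_mul_cosh x - phi0 x * Qs_mul_sinh x
    - (3 + 15 * Qs x ^ 2) * h'

/-- Solvability of `L u = f` by variation of constants. -/
theorem exists_solution_of_orthogonal {ε : ℝ} {f : ℝ → ℝ} (hf : ExpClass (-1) f)
    (hpar : ∀ x, f (-x) = ε * f x) (horth : ∫ x, phi0 x * Qs x * f x = 0) :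
    ∃ u u' : ℝ → ℝ, ExpClass (-1) u ∧ (∀ x, u (-x) = ε * u x) ∧ (∀ x, HasDerivAt u (u' x) x) ∧
      ∀ x, HasDerivAt u' (u x - 2 * Qs x * u x - f x) x := by
  obtain ⟨I, hI, hIpar, hI'⟩ := (expClass_phi0_mul_Qs.mul hf (r := -2) (by norm_num)).exists_antideriv
    (ε := -ε) (by norm_num) (fun x => by rw [phi0_neg, Qs_neg, hpar]; ring) horth
  have hqf : ExpClass 0 (fun x => growingSol x * f x) := expClass_growingSol.mul hf (by norm_num)
  have hJ := hqf.intervalIntegral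
  have hJ' : ∀ x, HasDerivAt (fun x => ∫ y in (0 : ℝ)..x, growingSol y * f y)
      (growingSol x * f x) x := fun x =>
    intervalIntegral.integral_hasDerivAt_right (hqf.continuous.intervalIntegrable 0 x)
      (hqf.continuous.stronglyMeasurableAtFilter _ _) hqf.continuous.continuousAt
  have hJpar := intervalIntegral_neg_of_parity (ε := ε) (f := fun x => growingSol x * f x)
    fun x => by rw [growingSol_neg, hpar]; ring
  set J : ℝ → ℝ := fun x => ∫ y in (0 : ℝ)..x, growingSol y * f y with hJdef
  refine ⟨fun x => 1 / 6 * (phi0 x * Qs x * J x - growingSol x * I x),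
    fun x => 1 / 6 * ((Qs x ^ 2 - Qs x) * J x - growingSolDeriv x * I x),
    ((expClass_phi0_mul_Qs.mul hJ (by norm_num)).sub
      (expClass_growingSol.mul hI (by norm_num))).const_mul _, fun x => ?_, fun x => ?_, fun x => ?_⟩
  · simp only [phi0_neg, Qs_neg, growingSol_neg, hIpar, hJdef, hJpar]
    ring
  · refine ((((hasDerivAt_phi0_mul_Qs x).mul (hJ' x)).sub
      ((hasDerivAt_growingSol x).mul (hI' x))).const_mul (1 / 6)).congr_deriv ?_
    ring
  · refine (((((hasDerivAt_Qs_sq x).fun_sub (hasDerivAt_Qs x)).mul (hJ' x)).sub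
      ((hasDerivAt_growingSolDeriv x).mul (hI' x))).const_mul (1 / 6)).congr_deriv ?_
    linear_combination 1 / 6 * f x * wronskian_growingSol x

theorem iteratedDeriv_two_of_hasDerivAt {f f' : ℝ → ℝ} {f'' x : ℝ}
    (h : ∀ x, HasDerivAt f (f' x) x) (h' : HasDerivAt f' f'' x) : iteratedDeriv 2 f x = f'' := by
  rw [iteratedDeriv_succ, iteratedDeriv_one, show deriv f = f' from funext fun x => (h x).deriv,
    h'.deriv]

theorem iteratedDeriv_two_Qs (x : ℝ) : iteratedDeriv 2 Qs x = Qs x - Qs x ^ 2 := by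
  refine iteratedDeriv_two_of_hasDerivAt hasDerivAt_Qs
    ((hasDerivAt_phi0_mul_Qs x).neg.congr_deriv ?_)
  ring

/-- The even function `R = Q + (k/2) x Q'`, which solves `L R = -(k Q'' + Q²)`. -/
noncomputable def scalingSol (k x : ℝ) : ℝ := Qs x - k / 2 * (x * (phi0 x * Qs x))

/-- The derivative of `scalingSol k`. -/
noncomputable def scalingSolDeriv (k x : ℝ) : ℝ :=
  -((1 + k / 2) * (phi0 x * Qs x)) - k / 2 * (x * (Qs x ^ 2 - Qs x))

/-- The second derivative of `scalingSol k`. -/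
noncomputable def scalingSolDeriv2 (k x : ℝ) : ℝ :=
  (1 + k) * (Qs x - Qs x ^ 2) + k / 2 * (x * ((2 * Qs x - 1) * (phi0 x * Qs x)))

theorem hasDerivAt_scalingSol (k x : ℝ) :
    HasDerivAt (scalingSol k) (scalingSolDeriv k x) x := by
  refine ((hasDerivAt_Qs x).sub
    (((hasDerivAt_id x).mul (hasDerivAt_phi0_mul_Qs x)).const_mul (k / 2))).congr_deriv ?_
  simp only [scalingSolDeriv, id]
  ring

theorem hasDerivAt_scalingSolDeriv (k x : ℝ) :
    HasDerivAt (scalingSolDeriv k) (scalingSolDeriv2 k x) x := by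
  refine (((hasDerivAt_phi0_mul_Qs x).const_mul (1 + k / 2)).neg.sub
    (((hasDerivAt_id x).mul ((hasDerivAt_Qs_sq x).fun_sub (hasDerivAt_Qs x))).const_mul
      (k / 2))).congr_deriv ?_
  simp only [scalingSolDeriv2, id]
  ring

theorem scalingSol_neg (k x : ℝ) : scalingSol k (-x) = scalingSol k x := by
  simp [scalingSol, Qs_neg, phi0_neg]

theorem scalingSolDeriv2_neg (k x : ℝ) : scalingSolDeriv2 k (-x) = scalingSolDeriv2 k x := by
  simp [scalingSolDeriv2, Qs_neg, phi0_neg]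

theorem expClass_scalingSol (k : ℝ) : ExpClass (-1) (scalingSol k) :=
  expClass_Qs.sub ((ExpClass.id.mul expClass_phi0_mul_Qs (by norm_num)).const_mul _)

theorem scalingSol_equation (k x : ℝ) :
    -scalingSolDeriv2 k x + scalingSol k x - 2 * Qs x * scalingSol k x =
      -(k * (Qs x - Qs x ^ 2) + Qs x ^ 2) := by
  rw [scalingSol, scalingSolDeriv2]
  ring

theorem expClass_of_two_hasDerivAt {s : ℝ} {f f' f'' : ℝ → ℝ} (hf : ExpClass s f)
    (h : ∀ x, HasDerivAt f (f' x) x) (h' : ∀ x, HasDerivAt f' (f'' x) x) :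
    ExpClass s f' ∧ ExpClass s f'' := by
  have e : deriv f = f' := funext fun x => (h x).deriv
  have e' : deriv f' = f'' := funext fun x => (h' x).deriv
  have hc : ExpClass s f' := e ▸ hf.deriv
  exact ⟨hc, e' ▸ hc.deriv⟩

/-- The coefficient of `a` in the solvability condition of the second equation. -/
noncomputable def scalingDefect (k x : ℝ) : ℝ :=
  k * scalingSolDeriv2 k x + 2 * Qs x * scalingSol k x - (2 * k - 3) * (Qs x - Qs x ^ 2)

theorem expClass_Qs_sq : ExpClass (-1) (fun x => Qs x ^ 2) := expClass_Qs.pow_two (by norm_num)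

theorem expClass_scalingDefect (k : ℝ) : ExpClass (-1) (scalingDefect k) := by
  have h := expClass_of_two_hasDerivAt (expClass_scalingSol k) (hasDerivAt_scalingSol k)
    (hasDerivAt_scalingSolDeriv k)
  exact ((h.2.const_mul k).add
    ((expClass_Qs.const_mul 2).mul (expClass_scalingSol k) (by norm_num))).sub
    ((expClass_Qs.sub expClass_Qs_sq).const_mul _)

theorem integral_scalingDefect_mul_Qs (k : ℝ) :
    ∫ x, scalingDefect k x * Qs x = (9 - k - k ^ 2 / 4) / 5 * ∫ x, Qs x := by
  have hR := expClass_scalingSol k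
  have hR' := (expClass_of_two_hasDerivAt hR (hasDerivAt_scalingSol k)
    (hasDerivAt_scalingSolDeriv k)).1
  have hφQ := expClass_phi0_mul_Qs
  have hd : ∀ x, HasDerivAt (fun x => k * (scalingSolDeriv k x * Qs x
      + scalingSol k x * (phi0 x * Qs x))
      + k / 2 * (x * (Qs x ^ 2 * (k / 2 + (2 - k) / 3 * Qs x)))
      + 3 / 5 * (-1 + 2 * k / 3 + k ^ 2 / 6) * (phi0 x * Qs x * Qs x)
      + (9 - k - k ^ 2 / 4) / 5 * (phi0 x * Qs x))
      (scalingDefect k x * Qs x - (9 - k - k ^ 2 / 4) / 5 * Qs x) x := fun x => by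
    refine ((((((hasDerivAt_scalingSolDeriv k x).mul (hasDerivAt_Qs x)).add
      ((hasDerivAt_scalingSol k x).mul (hasDerivAt_phi0_mul_Qs x))).const_mul k).add
      (((hasDerivAt_id x).mul ((hasDerivAt_Qs_sq x).fun_mul
        (((hasDerivAt_Qs x).const_mul ((2 - k) / 3)).const_add (k / 2)))).const_mul (k / 2))).add
      (((hasDerivAt_phi0_mul_Qs x).mul (hasDerivAt_Qs x)).const_mul
        (3 / 5 * (-1 + 2 * k / 3 + k ^ 2 / 6))) |>.add
      ((hasDerivAt_phi0_mul_Qs x).const_mul ((9 - k - k ^ 2 / 4) / 5))).congr_deriv ?_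
    simp only [scalingDefect, scalingSol, scalingSolDeriv, scalingSolDeriv2, id, Qs_eq_phi0]
    ring
  have hmem : ExpClass (-1) (fun x => k * (scalingSolDeriv k x * Qs x
      + scalingSol k x * (phi0 x * Qs x))
      + k / 2 * (x * (Qs x ^ 2 * (k / 2 + (2 - k) / 3 * Qs x)))
      + 3 / 5 * (-1 + 2 * k / 3 + k ^ 2 / 6) * (phi0 x * Qs x * Qs x)
      + (9 - k - k ^ 2 / 4) / 5 * (phi0 x * Qs x)) := by
    refine ((((hR'.mul expClass_Qs ?_).add (hR.mul hφQ ?_)).const_mul k).add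
      ((ExpClass.id.mul (expClass_Qs_sq.mul ((ExpClass.const (k / 2)).add
        ((expClass_Qs.const_mul ((2 - k) / 3)).mono ?_)) le_rfl) ?_).const_mul (k / 2))).add
      ((hφQ.mul expClass_Qs ?_).const_mul _) |>.add (hφQ.const_mul _) <;> norm_num
  have hi : Integrable (fun x => scalingDefect k x * Qs x) :=
    ((expClass_scalingDefect k).mul expClass_Qs le_rfl).integrable (by norm_num)
  have hQ : Integrable Qs := expClass_Qs.integrable (by norm_num)
  have h := hmem.integral_eq_zero_of_hasDerivAt (by norm_num) hd
  rw [integral_sub hi (hQ.const_mul _), integral_const_mul] at h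
  linarith

/-- existence for the model problem `(Ω)`. -/
theorem model_problem_existence (lam : ℝ) (hlam : lam ∈ Set.Ioo (0:ℝ) 1)
    (F G : ℝ → ℝ) (hF : inY F) (hFodd : ∀ x : ℝ, F (-x) = -F x)
    (hG : inY G) (hGeven : ∀ x : ℝ, G (-x) = G x) (γ : ℝ) :
    ∃ (a b : ℝ) (Atil Btil : ℝ → ℝ),
      inY Atil ∧ (∀ x : ℝ, Atil (-x) = Atil x) ∧
      inY Btil ∧ (∀ x : ℝ, Btil (-x) = -Btil x) ∧
      (∀ x : ℝ, deriv (Lop (fun y => Atil y + γ)) x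
          + a * deriv (fun y => (3 - lam) * iteratedDeriv 2 Qs y + (Qs y)^2) x = F x) ∧
      (∀ x : ℝ, deriv (Lop (fun y => Btil y + b * phi0 y)) x
          + a * (3 - 2*lam) * iteratedDeriv 2 Qs x
          - (3 - lam) * iteratedDeriv 2 (fun y => Atil y + γ) x
          - 2 * Qs x * (Atil x + γ) = G x) := by
  obtain ⟨hl0, hl1⟩ := hlam
  have hm1 : (-1 : ℝ) < 0 := by norm_num
  have hQ := expClass_Qs
  have hφQ := expClass_phi0_mul_Qs
  have hF' := ExpClass.of_inY hF
  have hG' := ExpClass.of_inY hG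
  obtain ⟨F₁, hF₁, hF₁par, hF₁'⟩ := hF'.exists_antideriv (ε := -1) hm1
    (fun x => by rw [hFodd]; ring) (integral_eq_zero_of_odd hFodd)
  simp only [neg_neg, one_mul] at hF₁par
  obtain ⟨A₀, A₀', hA₀, hA₀par, hA₀', hA₀''⟩ := exists_solution_of_orthogonal (ε := 1)
    (hF₁.add (hQ.const_mul (2 * γ))) (fun x => by rw [hF₁par, Qs_neg]; ring)
    (integral_eq_zero_of_odd fun x => by rw [hF₁par, Qs_neg, phi0_neg]; ring)
  have hA₀2 := (expClass_of_two_hasDerivAt hA₀ hA₀' hA₀'').2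
  simp only [one_mul] at hA₀par
  set A₂ : ℝ → ℝ := fun x => A₀ x - 2 * Qs x * A₀ x - (F₁ x + 2 * γ * Qs x) with hA₂
  have hA₂par : ∀ x, A₂ (-x) = A₂ x := fun x => by simp only [hA₂, hA₀par, hF₁par, Qs_neg]
  set k := 3 - lam
  set D : ℝ → ℝ := fun x => G x + k * A₂ x + 2 * Qs x * (A₀ x + γ) with hD
  have hDc : ExpClass (-1) D := by
    refine (hG'.add (hA₀2.const_mul k)).add ((hQ.const_mul 2).mul
      ((hA₀.mono ?_).add (ExpClass.const γ)) ?_) <;> norm_num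
  have hsc := integral_scalingDefect_mul_Qs k
  have hc1 : ∫ x, scalingDefect k x * Qs x ≠ 0 := by
    rw [hsc]
    refine (mul_pos ?_ integral_Qs_pos).ne'
    nlinarith
  set a := -(∫ x, D x * Qs x) / ∫ x, scalingDefect k x * Qs x with ha
  set H : ℝ → ℝ := fun x => D x + a * scalingDefect k x with hH
  have hHc : ExpClass (-1) H := hDc.add ((expClass_scalingDefect k).const_mul a)
  have hHpar : ∀ x, H (-x) = H x := fun x => by
    simp only [hH, hD, hA₂par, hA₀par, hGeven, scalingDefect, scalingSol_neg, scalingSolDeriv2_neg,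
      Qs_neg]
  have hHQ : ∫ x, H x * Qs x = 0 := by
    have i1 : Integrable fun x => D x * Qs x := (hDc.mul hQ le_rfl).integrable (by norm_num)
    have i2 : Integrable fun x => scalingDefect k x * Qs x :=
      ((expClass_scalingDefect k).mul hQ le_rfl).integrable (by norm_num)
    simp only [hH, add_mul, mul_assoc]
    rw [integral_add i1 (i2.const_mul a), integral_const_mul, ha, div_mul_cancel₀ _ hc1,
      add_neg_cancel]
  set b := 3 * (∫ x, H x) / ∫ x, Qs x with hb
  obtain ⟨E, hE, hEpar, hE'⟩ := (hHc.sub (hQ.const_mul (b / 3))).exists_antideriv (ε := 1) hm1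
    (fun x => by rw [hHpar, Qs_neg, one_mul]) (by
      rw [integral_sub (hHc.integrable hm1) ((hQ.integrable hm1).const_mul _), integral_const_mul,
        hb]
      field_simp [integral_Qs_pos.ne']
      ring)
  have horth : ∫ x, phi0 x * Qs x * (E x + 5 * b / 3 * (phi0 x * Qs x)) = 0 := by
    have hz : ExpClass (-1) fun x => E x * Qs x + 2 * b / 3 * (phi0 x * Qs x * Qs x) :=
      (hE.mul hQ (by norm_num)).add ((hφQ.mul hQ (by norm_num)).const_mul _)
    have hz' := hz.integral_eq_zero_of_hasDerivAt (g := fun x => H x * Qs x -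
      phi0 x * Qs x * (E x + 5 * b / 3 * (phi0 x * Qs x))) hm1 fun x => by
        refine (((hE' x).mul (hasDerivAt_Qs x)).add
          (((hasDerivAt_phi0_mul_Qs x).mul (hasDerivAt_Qs x)).const_mul (2 * b / 3))).congr_deriv ?_
        simp only [Qs_eq_phi0]
        ring
    rw [integral_sub ((hHc.mul hQ le_rfl).integrable (by norm_num))
      ((hφQ.mul (hE.add (hφQ.const_mul _)) le_rfl).integrable (by norm_num)), hHQ] at hz'
    linarith
  obtain ⟨B, B', hB, hBpar, hB', hB''⟩ := exists_solution_of_orthogonal (ε := -1)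
    (hE.add (hφQ.const_mul (5 * b / 3))) (fun x => by rw [hEpar, Qs_neg, phi0_neg]; ring) horth
  have hA1 : ∀ x, HasDerivAt (fun y => A₀ y + a * scalingSol k y + γ)
      (A₀' x + a * scalingSolDeriv k x) x := fun x =>
    ((hA₀' x).add ((hasDerivAt_scalingSol k x).const_mul a)).add_const γ
  have hA2 : ∀ x, iteratedDeriv 2 (fun y => A₀ y + a * scalingSol k y + γ) x =
      A₂ x + a * scalingSolDeriv2 k x := fun x =>
    iteratedDeriv_two_of_hasDerivAt hA1
      ((hA₀'' x).add ((hasDerivAt_scalingSolDeriv k x).const_mul a))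
  have hB2 : ∀ x, iteratedDeriv 2 (fun y => B y + b * phi0 y) x =
      B x - 2 * Qs x * B x - (E x + 5 * b / 3 * (phi0 x * Qs x))
        + b * (-(phi0 x * Qs x) / 3) := fun x =>
    iteratedDeriv_two_of_hasDerivAt (fun x => (hB' x).add ((hasDerivAt_phi0 x).const_mul b))
      ((hB'' x).add (((hasDerivAt_Qs x).div_const 3).const_mul b))
  have hLA : Lop (fun y => A₀ y + a * scalingSol k y + γ) =
      fun x => F₁ x + γ - a * (k * (Qs x - Qs x ^ 2) + Qs x ^ 2) := funext fun x => by
    rw [Lop, hA2]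
    linear_combination a * scalingSol_equation k x
  have hLB : Lop (fun y => B y + b * phi0 y) = fun x => E x + b * phi0 x := funext fun x => by
    rw [Lop, hB2]
    ring
  refine ⟨a, b, fun x => A₀ x + a * scalingSol k x, B,
    (hA₀.add ((expClass_scalingSol k).const_mul a)).inY,
    fun x => by simp only [hA₀par, scalingSol_neg], hB.inY, fun x => by rw [hBpar]; ring,
    fun x => ?_, fun x => ?_⟩
  · have hP : HasDerivAt (fun y => k * (Qs y - Qs y ^ 2) + Qs y ^ 2) _ x :=
      (((hasDerivAt_Qs x).sub (hasDerivAt_Qs_sq x)).const_mul k).add (hasDerivAt_Qs_sq x)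
    simp only [iteratedDeriv_two_Qs]
    rw [hLA, (((hF₁' x).add_const γ).fun_sub (hP.const_mul a)).deriv, hP.deriv]
    ring
  · rw [hLB, ((hE' x).fun_add ((hasDerivAt_phi0 x).const_mul b)).deriv, hA2, iteratedDeriv_two_Qs]
    simp only [hH, hD, scalingDefect]
    ring
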